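/- Let F = (V_0,…,V_{k−1}) be an isotropic partial flag of type d in V with completion (V̄_0,…,V̄_{2k−1}), and let c and c′ be two admissible self-dual sequences. Define max{c,c′} as the sequence whose p-th term is max{c_p, c′_p}; it is again admissible and self-dual. Then 𝔦^F_c + 𝔦^F_{c′} = 𝔦^F_{max{c,c′}} as subspaces of 𝔤. -/

import Mathlib

open Module Submodule

noncomputable section

/-- The orthogonal `W^⊥ = {v : ω(v,w) = 0 for all w ∈ W}` of a subspace with respect to a
bilinear form `ω`. -/
def ortho {V : Type*} [AddCommGroup V] [Module ℂ V]
    (ω : V →ₗ[ℂ] V →ₗ[ℂ] ℂ) (W : Submodule ℂ V) : Submodule ℂ V where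
  carrier := {v | ∀ w ∈ W, ω v w = 0}
  zero_mem' := by intro w _; simp
  add_mem' := by
    intro a b ha hb w hw
    rw [map_add, LinearMap.add_apply, ha w hw, hb w hw, add_zero]
  smul_mem' := by
    intro t a ha w hw
    rw [map_smul, LinearMap.smul_apply, ha w hw, smul_zero]

/-- The completion `(V̄_0, …, V̄_{2k−1})` of an isotropic partial flag `(V_0, …, V_{k−1})`:
`V̄_p = V_p` for `p ≤ k−1` and `V̄_p = (V_{2k−1−p})^⊥` for `k ≤ p ≤ 2k−1`. -/
def completion {V : Type*} [AddCommGroup V] [Module ℂ V]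
    (ω : V →ₗ[ℂ] V →ₗ[ℂ] ℂ) {k : ℕ} (W : Fin k → Submodule ℂ V) :
    ℕ → Submodule ℂ V := fun p =>
  if h : p < k then W ⟨p, h⟩
  else if h2 : 2 * k - 1 - p < k then ortho ω (W ⟨2 * k - 1 - p, h2⟩) else ⊥

/-- An endomorphism `x` is skew-adjoint with respect to `ω` if `ω(x v, w) = −ω(v, x w)`
for all `v, w`; this says `x ∈ 𝔤`. -/
def SkewAdjWrt {V : Type*} [AddCommGroup V] [Module ℂ V]
    (ω : V →ₗ[ℂ] V →ₗ[ℂ] ℂ) (x : Module.End ℂ V) : Prop :=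
  ∀ v w, ω (x v) w = - ω v (x w)


lemma sd_key (k : ℕ) (c : ℕ → ℕ)
    (hcmono : ∀ p q, p ≤ q → q < 2 * k → c p ≤ c q)
    (hcsd : ∀ p < 2 * k, c p = ((Finset.Ico 1 (2 * k)).filter fun q => 2 * k - p ≤ c q).card)
    (p q : ℕ) (hp : p < 2 * k) (hq1 : 1 ≤ q) (hq : q < 2 * k) :
    2 * k - p ≤ c q ↔ 2 * k - c p ≤ q := by
  constructor
  · intro h
    have hs : Finset.Ico q (2 * k) ⊆
        (Finset.Ico 1 (2 * k)).filter fun q => 2 * k - p ≤ c q := by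
      intro r hr
      rw [Finset.mem_Ico] at hr
      rw [Finset.mem_filter, Finset.mem_Ico]
      have := hcmono q r hr.1 hr.2
      omega
    have := Finset.card_le_card hs
    rw [← hcsd p hp, Nat.card_Ico] at this
    omega
  · intro h
    by_contra hn
    have hs : ((Finset.Ico 1 (2 * k)).filter fun q => 2 * k - p ≤ c q) ⊆
        Finset.Ico (q + 1) (2 * k) := by
      intro r hr
      rw [Finset.mem_filter, Finset.mem_Ico] at hr
      rw [Finset.mem_Ico]
      refine ⟨?_, hr.1.2⟩
      by_contra h2
      have := hcmono r q (by omega) hq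
      omega
    have := Finset.card_le_card hs
    rw [← hcsd p hp, Nat.card_Ico] at this
    omega

lemma gl_decomp {V : Type*} [AddCommGroup V] [Module ℂ V] (G : ℕ → Submodule ℂ V) (N : ℕ)
    (hG0 : G 0 = ⊥) (hG : ∀ p q, p ≤ q → q < N → G p ≤ G q) (c c' : ℕ → ℕ)
    (hcmono : ∀ p q, p ≤ q → q < N → c p ≤ c q)
    (hc'mono : ∀ p q, p ≤ q → q < N → c' p ≤ c' q)
    (hcle : ∀ p < N, c p ≤ p) (hc'le : ∀ p < N, c' p ≤ p)
    (x : Module.End ℂ V) (hx : ∀ p < N, ∀ v ∈ G p, x v ∈ G (max (c p) (c' p))) (n : ℕ) :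
    n < N → ∃ y : Module.End ℂ V, ∀ p ≤ n, ∀ v ∈ G p, y v ∈ G (c p) ∧ x v - y v ∈ G (c' p) := by
  induction n with
  | zero =>
    intro _
    refine ⟨0, fun p hp v hv => ?_⟩
    obtain rfl : p = 0 := by omega
    rw [hG0, Submodule.mem_bot] at hv
    subst hv
    simp
  | succ n ih =>
    intro hn
    obtain ⟨y, hy⟩ := ih (by omega)
    obtain ⟨P, hP⟩ := (G n).subtype.exists_leftInverse_of_injective (by simp)
    have hPid : ∀ v ∈ G n, ((P v : G n) : V) = v := by
      intro v hv
      have := LinearMap.congr_fun hP ⟨v, hv⟩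
      simpa using congrArg Subtype.val this
    let π : Module.End ℂ V := (G n).subtype ∘ₗ P
    have hπ : ∀ v ∈ G n, π v = v := hPid
    have hπm : ∀ v, π v ∈ G n := fun v => (P v).2
    have hmono := hG n (n + 1) (by omega) hn
    have l1 := hcle (n + 1) hn
    have l2 := hc'le (n + 1) hn
    have m1 := hG _ _ (hcmono n (n + 1) (by omega) hn) (by omega)
    have m2 := hG _ _ (hc'mono n (n + 1) (by omega) hn) (by omega)
    rcases le_total (c' (n + 1)) (c (n + 1)) with hcc | hcc
    · refine ⟨y ∘ₗ π + x ∘ₗ (LinearMap.id - π), fun p hp v hv => ?_⟩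
      rcases Nat.lt_or_ge n p with h | h
      · obtain rfl : p = n + 1 := by omega
        have h1 := hy n le_rfl (π v) (hπm v)
        have h2 := hx (n + 1) hn (v - π v) (Submodule.sub_mem _ hv (hmono (hπm v)))
        rw [max_eq_left hcc] at h2
        constructor
        · exact Submodule.add_mem _ (m1 h1.1) h2
        · have : x v - (y ∘ₗ π + x ∘ₗ (LinearMap.id - π) : Module.End ℂ V) v = x (π v) - y (π v) := by
            simp; abel
          rw [this]
          exact m2 h1.2
      · have := hy p h v hv
        simpa [hπ v (hG p n h (by omega) hv)] using this
    · refine ⟨y ∘ₗ π, fun p hp v hv => ?_⟩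
      rcases Nat.lt_or_ge n p with h | h
      · obtain rfl : p = n + 1 := by omega
        have h1 := hy n le_rfl (π v) (hπm v)
        have h2 := hx (n + 1) hn (v - π v) (Submodule.sub_mem _ hv (hmono (hπm v)))
        rw [max_eq_right hcc] at h2
        constructor
        · exact m1 h1.1
        · have : x v - (y ∘ₗ π) v = (x (π v) - y (π v)) + x (v - π v) := by
            simp
          rw [this]
          exact Submodule.add_mem _ (m2 h1.2) h2
      · have := hy p h v hv
        simpa [hπ v (hG p n h (by omega) hv)] using this

lemma exists_adj {V : Type*} [AddCommGroup V] [Module ℂ V] [FiniteDimensional ℂ V]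
    (ω : V →ₗ[ℂ] V →ₗ[ℂ] ℂ)
    (hnd : ∀ v, (∀ w, ω v w = 0) → v = 0) (y : Module.End ℂ V) :
    ∃ z : Module.End ℂ V, ∀ v w, ω (z v) w = ω v (y w) := by
  have hinj : Function.Injective ω := by
    rw [injective_iff_map_eq_zero]
    intro v hv
    exact hnd v (fun w => by rw [hv]; rfl)
  let e : V ≃ₗ[ℂ] Module.Dual ℂ V :=
    LinearEquiv.ofInjectiveOfFinrankEq ω hinj (Subspace.dual_finrank_eq).symm
  have he : ∀ v, e v = ω v := fun v => rfl
  refine ⟨e.symm.toLinearMap ∘ₗ (LinearMap.lcomp ℂ ℂ y) ∘ₗ ω, fun v w => ?_⟩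
  have : ω (e.symm ((LinearMap.lcomp ℂ ℂ y) (ω v))) = (LinearMap.lcomp ℂ ℂ y) (ω v) := by
    rw [← he, LinearEquiv.apply_symm_apply]
  exact LinearMap.congr_fun this w

lemma double_ortho {V : Type*} [AddCommGroup V] [Module ℂ V] [FiniteDimensional ℂ V]
    (ω : V →ₗ[ℂ] V →ₗ[ℂ] ℂ)
    (hnd : ∀ v, (∀ w, ω v w = 0) → v = 0)
    (ε : ℂ) (hε : ∀ v w, ω v w = ε * ω w v)
    (W : Submodule ℂ V) (v : V) (hv : ∀ w ∈ ortho ω W, ω v w = 0) : v ∈ W := by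
  have hrefl : LinearMap.BilinForm.IsRefl ω := by
    intro a b h
    rw [hε, h, mul_zero]
  have hnd' : LinearMap.BilinForm.Nondegenerate ω := by
    refine ⟨hnd, fun v h => hnd v fun w => ?_⟩
    rw [hε, h, mul_zero]
  rw [← LinearMap.BilinForm.orthogonal_orthogonal hnd' hrefl W]
  intro w hw
  apply hrefl
  apply hv
  intro u hu
  exact hrefl _ _ (hw u hu)

/-- For two admissible self-dual sequences `c, c′`, the sequence
`max{c,c′}` is again admissible and self-dual, and `𝔦^F_c + 𝔦^F_{c′} = 𝔦^F_{max{c,c′}}`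
as subspaces of `𝔤`. -/
theorem stmt_12 (V : Type*) [AddCommGroup V] [Module ℂ V] [FiniteDimensional ℂ V]
    (m : ℕ) (hdimV : finrank ℂ V = m)
    (ω : V →ₗ[ℂ] V →ₗ[ℂ] ℂ)
    (hnd : ∀ v, (∀ w, ω v w = 0) → v = 0)
    (hso : (∀ v w, ω v w = ω w v) ∨ (∀ v, ω v v = 0))
    (k : ℕ) (hk : 2 ≤ k)
    (d : Fin k → ℕ) (hd0 : d ⟨0, by omega⟩ = 0) (hdsm : StrictMono d)
    (hdm : 2 * d ⟨k - 1, by omega⟩ ≤ m)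
    (F : Fin k → Submodule ℂ V) (hFmono : Monotone F)
    (hFiso : ∀ p, ∀ v ∈ F p, ∀ w ∈ F p, ω v w = 0)
    (hFdim : ∀ p, finrank ℂ (F p) = d p)
    (c c' : ℕ → ℕ)
    (hcmono : ∀ p q, p ≤ q → q < 2 * k → c p ≤ c q)
    (hc'mono : ∀ p q, p ≤ q → q < 2 * k → c' p ≤ c' q)
    (hcle : ∀ p < 2 * k, c p ≤ p) (hc'le : ∀ p < 2 * k, c' p ≤ p)
    (hcsd : ∀ p < 2 * k, c p = ((Finset.Ico 1 (2 * k)).filter fun q => 2 * k - p ≤ c q).card)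
    (hc'sd : ∀ p < 2 * k,
      c' p = ((Finset.Ico 1 (2 * k)).filter fun q => 2 * k - p ≤ c' q).card) :
    (∀ p q, p ≤ q → q < 2 * k → max (c p) (c' p) ≤ max (c q) (c' q)) ∧
    (∀ p < 2 * k, max (c p) (c' p) ≤ p) ∧
    (∀ p < 2 * k, max (c p) (c' p) =
      ((Finset.Ico 1 (2 * k)).filter fun q => 2 * k - p ≤ max (c q) (c' q)).card) ∧
    (∀ x : Module.End ℂ V,
      (SkewAdjWrt ω x ∧
        ∀ p < 2 * k, (completion ω F p).map x ≤ completion ω F (max (c p) (c' p))) ↔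
      ∃ y z : Module.End ℂ V,
        (SkewAdjWrt ω y ∧
          ∀ p < 2 * k, (completion ω F p).map y ≤ completion ω F (c p)) ∧
        (SkewAdjWrt ω z ∧
          ∀ p < 2 * k, (completion ω F p).map z ≤ completion ω F (c' p)) ∧
        x = y + z) := by
  obtain ⟨ε, hε2, hε⟩ : ∃ ε : ℂ, ε * ε = 1 ∧ ∀ v w, ω v w = ε * ω w v := by
    rcases hso with h | h
    · exact ⟨1, by simp, fun v w => by rw [one_mul]; exact h v w⟩
    · refine ⟨-1, by simp, fun v w => ?_⟩
      have := h (v + w)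
      simp only [map_add, LinearMap.add_apply, h, zero_add, add_zero] at this
      linear_combination this
  have key := sd_key k c hcmono hcsd
  have key' := sd_key k c' hc'mono hc'sd
  set G := completion ω F with hGdef
  have hGlt : ∀ p (h : p < k), G p = F ⟨p, h⟩ := fun p h => by
    simp [hGdef, completion, h]
  have hGge : ∀ p (h : k ≤ p) (h2 : 2 * k - 1 - p < k), G p = ortho ω (F ⟨2 * k - 1 - p, h2⟩) :=
    fun p h h2 => by
      simp only [hGdef, completion]
      rw [dif_neg (by omega), dif_pos h2]
  have hG0 : G 0 = ⊥ := by
    rw [hGlt 0 (by omega), ← Submodule.finrank_eq_zero, hFdim, hd0]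
  have hGmono : ∀ p q, p ≤ q → q < 2 * k → G p ≤ G q := by
    intro p q hpq hq
    by_cases h1 : q < k
    · rw [hGlt p (by omega), hGlt q h1]
      exact hFmono (by simpa using hpq)
    · rw [hGge q (by omega) (by omega)]
      by_cases h2 : p < k
      · rw [hGlt p h2]
        intro v hv w hw
        exact hFiso ⟨k - 1, by omega⟩ v (hFmono (by rw [Fin.mk_le_mk]; omega) hv) w
          (hFmono (by rw [Fin.mk_le_mk]; omega) hw)
      · rw [hGge p (by omega) (by omega)]
        intro v hv w hw
        exact hv w (hFmono (by rw [Fin.mk_le_mk]; omega) hw)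
  have hB : ∀ p < 2 * k, ∀ v ∈ G p, ∀ w ∈ G (2 * k - 1 - p), ω v w = 0 := by
    intro p hp v hv w hw
    by_cases h : p < k
    · have e : 2 * k - 1 - (2 * k - 1 - p) = p := by omega
      rw [hGge _ (by omega) (by omega)] at hw
      rw [hGlt p h] at hv
      rw [hε, hw v (by simpa only [e] using hv), mul_zero]
    · rw [hGge p (by omega) (by omega)] at hv
      rw [hGlt _ (by omega)] at hw
      exact hv w hw
  have hC : ∀ p < 2 * k, ∀ v, (∀ w ∈ G (2 * k - 1 - p), ω v w = 0) → v ∈ G p := by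
    intro p hp v hv
    by_cases h : p < k
    · have e : 2 * k - 1 - (2 * k - 1 - p) = p := by omega
      rw [hGge _ (by omega) (by omega)] at hv
      simp only [e] at hv
      rw [hGlt p h]
      exact double_ortho ω hnd ε hε _ v hv
    · rw [hGge p (by omega) (by omega)]
      rw [hGlt _ (by omega)] at hv
      exact hv
  have hadj : ∀ (c : ℕ → ℕ), (∀ p < 2 * k, c p ≤ p) →
      (∀ p q, p < 2 * k → 1 ≤ q → q < 2 * k → (2 * k - p ≤ c q ↔ 2 * k - c p ≤ q)) →
      ∀ y z : Module.End ℂ V, (∀ v w, ω (z v) w = ω v (y w)) →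
      (∀ p < 2 * k, ∀ v ∈ G p, y v ∈ G (c p)) → ∀ p < 2 * k, ∀ v ∈ G p, z v ∈ G (c p) := by
    intro c hcle key y z hz hy p hp v hv
    have hcp := hcle p hp
    refine hC _ (by omega) _ fun w hw => ?_
    rw [hz]
    refine hB p hp v hv _ ?_
    refine hGmono _ _ ?_ (by omega) (hy (2 * k - 1 - c p) (by omega) w hw)
    by_cases h0 : 1 ≤ 2 * k - 1 - c p
    · have := key p (2 * k - 1 - c p) hp h0 (by omega)
      omega
    · have := hcle (2 * k - 1 - c p) (by omega)
      omega
  have hmaxle : ∀ p < 2 * k, max (c p) (c' p) ≤ p := fun p hp => max_le (hcle p hp) (hc'le p hp)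
  refine ⟨fun p q h1 h2 => max_le_max (hcmono p q h1 h2) (hc'mono p q h1 h2), hmaxle, ?_, ?_⟩
  · intro p hp
    have : ((Finset.Ico 1 (2 * k)).filter fun q => 2 * k - p ≤ max (c q) (c' q)) =
        Finset.Ico (2 * k - max (c p) (c' p)) (2 * k) := by
      ext q
      rw [Finset.mem_filter, Finset.mem_Ico, Finset.mem_Ico]
      have := hmaxle p hp
      constructor
      · rintro ⟨⟨h1, h2⟩, h3⟩
        have a := key p q hp h1 h2
        have b := key' p q hp h1 h2
        omega
      · rintro ⟨h1, h2⟩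
        have a := key p q hp (by omega) h2
        have b := key' p q hp (by omega) h2
        omega
    rw [this, Nat.card_Ico]
    have := hmaxle p hp
    omega
  · intro x
    constructor
    · rintro ⟨hxs, hx⟩
      have hx' : ∀ p < 2 * k, ∀ v ∈ G p, x v ∈ G (max (c p) (c' p)) :=
        fun p hp v hv => hx p hp (Submodule.mem_map_of_mem hv)
      obtain ⟨y, hy⟩ := gl_decomp G (2 * k) hG0 hGmono c c' hcmono hc'mono hcle hc'le x hx'
        (2 * k - 1) (by omega)
      obtain ⟨t, ht⟩ := exists_adj ω hnd y
      have ht2 : ∀ v w, ω v (t w) = ω (y v) w := by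
        intro v w
        rw [hε, ht, hε, ← mul_assoc, hε2, one_mul]
      have hyt := hadj c hcle key y t ht (fun p hp v hv => (hy p (by omega) v hv).1)
      have hzt := hadj c' hc'le key' (x - y) (-x - t)
        (fun v w => by simp [ht, hxs v w])
        (fun p hp v hv => (hy p (by omega) v hv).2)
      refine ⟨(1 / 2 : ℂ) • (y - t), (1 / 2 : ℂ) • ((x - y) - (-x - t)), ⟨?_, ?_⟩, ⟨?_, ?_⟩, ?_⟩
      · intro v w
        simp [ht, ht2]
        ring
      · intro p hp
        rw [Submodule.map_le_iff_le_comap]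
        intro v hv
        exact Submodule.smul_mem _ _ (Submodule.sub_mem _ (hy p (by omega) v hv).1 (hyt p hp v hv))
      · intro v w
        simp [ht, ht2, hxs v w]
        ring
      · intro p hp
        rw [Submodule.map_le_iff_le_comap]
        intro v hv
        exact Submodule.smul_mem _ _ (Submodule.sub_mem _ (hy p (by omega) v hv).2 (hzt p hp v hv))
      · module
    · rintro ⟨y, z, ⟨hys, hy⟩, ⟨hzs, hz⟩, rfl⟩
      refine ⟨fun v w => ?_, fun p hp => ?_⟩
      · simp [hys v w, hzs v w]
        ring
      · rw [Submodule.map_le_iff_le_comap]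
        intro v hv
        have h := hmaxle p hp
        exact Submodule.add_mem _
          (hGmono _ _ (le_max_left _ _) (by omega) (hy p hp (Submodule.mem_map_of_mem hv)))
          (hGmono _ _ (le_max_right _ _) (by omega) (hz p hp (Submodule.mem_map_of_mem hv)))
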